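/- In the Fraïssé limit M of the class K of finite edge-colored equivalence structures without monochromatic triangles, every permutation of the E-equivalence classes of M extends to an automorphism of M. -/

import Mathlib

def IsKStruct {V : Type*} (E : V → V → Prop) (C : ℕ → V → V → Prop) : Prop :=
  Equivalence E ∧
  (∀ (i : ℕ) (x y : V), C i x y → C i y x) ∧
  (∀ (i : ℕ) (x : V), ¬ C i x x) ∧
  (∀ x y : V, x ≠ y → ∃! i : ℕ, C i x y) ∧
  (∀ (i : ℕ) (x y z : V), x ≠ y → y ≠ z → x ≠ z → ¬ (C i x y ∧ C i y z ∧ C i x z))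

def IsKEmb {V W : Type*} (E₁ : V → V → Prop) (C₁ : ℕ → V → V → Prop)
    (E₂ : W → W → Prop) (C₂ : ℕ → W → W → Prop) (f : V → W) : Prop :=
  Function.Injective f ∧
  (∀ x y : V, E₁ x y ↔ E₂ (f x) (f y)) ∧
  (∀ (i : ℕ) (x y : V), C₁ i x y ↔ C₂ i (f x) (f y))

theorem ext_aux {M : Type*}
    (E : M → M → Prop) (C : ℕ → M → M → Prop)
    (hK : IsKStruct E C)
    (hage : ∀ (V : Type) [Fintype V] (E' : V → V → Prop) (C' : ℕ → V → V → Prop),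
      IsKStruct E' C' → ∃ f : V → M, IsKEmb E' C' E C f)
    (hhom : ∀ (s : Finset M) (f : M → M), Set.InjOn f ↑s →
      (∀ x ∈ s, ∀ y ∈ s, (E x y ↔ E (f x) (f y)) ∧ ∀ i : ℕ, C i x y ↔ C i (f x) (f y)) →
      ∃ g : M ≃ M, (∀ x y : M, E x y ↔ E (g x) (g y)) ∧
        (∀ (i : ℕ) (x y : M), C i x y ↔ C i (g x) (g y)) ∧ ∀ x ∈ s, g x = f x)
    (s : Finset M) (e : M) (he : e ∈ s) (col : M → ℕ)
    (hcol : ∀ x ∈ s, ∀ y ∈ s, x ≠ y → col x = col y → ¬ C (col x) x y) :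
    ∃ d, d ∉ s ∧ E d e ∧ ∀ x ∈ s, C (col x) d x := by
  classical
  obtain ⟨hE, hs, hi, hu, ht⟩ := hK
  let σ := s.equivFin
  let q : Fin s.card → M := fun i => (σ.symm i : M)
  have hq : Function.Injective q := fun a b h => σ.symm.injective (Subtype.ext h)
  have hqs : ∀ i, q i ∈ s := fun i => (σ.symm i).2
  let p : Option (Fin s.card) → M := fun o => o.elim e q
  let C' : ℕ → Option (Fin s.card) → Option (Fin s.card) → Prop := fun i x y =>
    match x, y with
    | some a, some b => C i (q a) (q b)
    | none, some b => i = col (q b)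
    | some a, none => i = col (q a)
    | none, none => False
  have hK' : IsKStruct (fun x y => E (p x) (p y)) C' := by
    refine ⟨⟨fun x => hE.refl _, fun h => hE.symm h, fun h h' => hE.trans h h'⟩, ?_, ?_, ?_, ?_⟩
    · rintro i (_ | x) (_ | y) h
      · exact h
      · exact h
      · exact h
      · exact hs _ _ _ h
    · rintro i (_ | x) h
      · exact h
      · exact hi _ _ h
    · rintro (_ | x) (_ | y) h
      · exact absurd rfl h
      · exact ⟨_, rfl, fun _ h => h⟩
      · exact ⟨_, rfl, fun _ h => h⟩
      · exact hu _ _ (fun h' => h (congrArg some (hq h')))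
    · have key : ∀ i x y, some x ≠ some y → i = col (q x) → i = col (q y) → ¬ C i (q x) (q y) := by
        intro i x y hxy h1 h2 h3
        subst h1
        exact hcol _ (hqs x) _ (hqs y) (fun h' => hxy (congrArg some (hq h'))) h2 h3
      rintro i (_ | x) (_ | y) (_ | z) hxy hyz hxz ⟨h1, h2, h3⟩
      · exact hxy rfl
      · exact hxy rfl
      · exact hxz rfl
      · exact key i y z hyz h1 h3 h2
      · exact hyz rfl
      · exact key i x z hxz h1 h2 h3
      · exact key i x y hxy h3 h2 h1
      · exact ht i (q x) (q y) (q z) (fun h' => hxy (congrArg some (hq h')))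
          (fun h' => hyz (congrArg some (hq h'))) (fun h' => hxz (congrArg some (hq h'))) ⟨h1, h2, h3⟩
  obtain ⟨f, hf, hfE, hfC⟩ := hage _ _ _ hK'
  let h : M → M := fun x => if hx : x ∈ s then f (some (σ ⟨x, hx⟩)) else x
  have hh : ∀ x (hx : x ∈ s), h x = f (some (σ ⟨x, hx⟩)) := fun x hx => dif_pos hx
  have hqσ : ∀ x (hx : x ∈ s), q (σ ⟨x, hx⟩) = x := fun x hx => by simp [q]
  obtain ⟨g, gE, gC, gs⟩ := hhom s h (by
    intro x hx y hy hxy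
    rw [hh x hx, hh y hy] at hxy
    have := σ.injective (Option.some.inj (hf hxy))
    exact congrArg Subtype.val this) (by
    intro x hx y hy
    rw [hh x hx, hh y hy, ← hfE]
    refine ⟨?_, fun i => ?_⟩
    · change _ ↔ E (q _) (q _)
      rw [hqσ, hqσ]
    · rw [← hfC]
      change _ ↔ C i (q _) (q _)
      rw [hqσ, hqσ])
  refine ⟨g.symm (f none), ?_, ?_, ?_⟩
  · intro hd
    have := gs _ hd
    rw [hh _ hd, Equiv.apply_symm_apply] at this
    exact absurd (hf this) (by simp)
  · rw [gE, Equiv.apply_symm_apply, gs e he, hh e he, ← hfE]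
    change E e (q _)
    rw [hqσ]; exact hE.refl _
  · intro x hx
    rw [gC, Equiv.apply_symm_apply, gs x hx, hh x hx, ← hfC]
    change col x = col (q _)
    rw [hqσ]

def GoodF {M Q : Type*} (C : ℕ → M → M → Prop) (cl : M → Q) (π : Q ≃ Q) (F : Finset (M × M)) : Prop :=
  (∀ p ∈ F, ∀ q ∈ F, (p.1 = q.1 ↔ p.2 = q.2) ∧ ∀ i, C i p.1 q.1 ↔ C i p.2 q.2) ∧
  ∀ p ∈ F, cl p.2 = π (cl p.1)

theorem GoodF.swap {M Q : Type*} {C : ℕ → M → M → Prop} {cl : M → Q} {π : Q ≃ Q}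
    {F : Finset (M × M)} (h : GoodF C cl π F) :
    GoodF C cl π.symm (F.map (Equiv.prodComm M M).toEmbedding) := by
  obtain ⟨h1, h2⟩ := h
  refine ⟨?_, ?_⟩
  · intro p hp q hq
    rw [Finset.mem_map_equiv] at hp hq
    obtain ⟨a, b⟩ := h1 _ hp _ hq
    exact ⟨a.symm, fun i => (b i).symm⟩
  · intro p hp
    rw [Finset.mem_map_equiv] at hp
    have := h2 _ hp
    rw [Equiv.eq_symm_apply]
    exact this.symm

theorem GoodF.extend {M Q : Type*} {E : M → M → Prop} {C : ℕ → M → M → Prop} (hK : IsKStruct E C)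
    {cl : M → Q} (hcl : ∀ x y, E x y ↔ cl x = cl y) (hsurj : Function.Surjective cl)
    (hext : ∀ (s : Finset M) (e : M) (_ : e ∈ s) (col : M → ℕ)
      (_ : ∀ x ∈ s, ∀ y ∈ s, x ≠ y → col x = col y → ¬ C (col x) x y),
      ∃ d, d ∉ s ∧ E d e ∧ ∀ x ∈ s, C (col x) d x)
    {π : Q ≃ Q} {F : Finset (M × M)} (h : GoodF C cl π F) (c : M) :
    ∃ F', F ⊆ F' ∧ GoodF C cl π F' ∧ ∃ d, (c, d) ∈ F' := by
  classical
  by_cases hc : ∃ d, (c, d) ∈ F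
  · exact ⟨F, subset_rfl, h, hc⟩
  obtain ⟨h1, h2⟩ := h
  obtain ⟨hE, hs, hi, hu, ht⟩ := hK
  obtain ⟨e, he⟩ := hsurj (π (cl c))
  have hk : ∀ x y, ∃ i, x ≠ y → C i x y := fun x y => by
    by_cases hxy : x = y
    · exact ⟨0, fun h => absurd hxy h⟩
    · obtain ⟨i, hi, _⟩ := hu x y hxy
      exact ⟨i, fun _ => hi⟩
  choose k hk using hk
  have hinv : ∀ b, ∃ a, b ∈ F.image Prod.snd → (a, b) ∈ F := fun b => by
    by_cases hb : b ∈ F.image Prod.snd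
    · obtain ⟨⟨a, b'⟩, hp, rfl⟩ := Finset.mem_image.1 hb
      exact ⟨a, fun _ => hp⟩
    · exact ⟨b, fun h => absurd h hb⟩
  choose inv hinv using hinv
  set B := F.image Prod.snd with hB
  have hinv' : ∀ a b, (a, b) ∈ F → inv b = a := fun a b hab => by
    have hb : b ∈ B := Finset.mem_image.2 ⟨_, hab, rfl⟩
    exact (h1 _ (hinv b hb) _ hab).1.2 rfl
  have hne : ∀ b ∈ B, c ≠ inv b := fun b hb hh => hc ⟨b, by rw [hh]; exact hinv b hb⟩
  obtain ⟨N, hN⟩ := Infinite.exists_notMem_finset (B.image fun b => k c (inv b))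
  have hN' : ∀ b ∈ B, k c (inv b) ≠ N := fun b hb hh => hN (Finset.mem_image.2 ⟨b, hb, hh⟩)
  let col : M → ℕ := fun x => if x ∈ B then k c (inv x) else N
  have hcolB : ∀ x ∈ B, col x = k c (inv x) := fun x hx => if_pos hx
  have hcolN : ∀ x ∉ B, col x = N := fun x hx => if_neg hx
  obtain ⟨d, hd, hde, hdC⟩ := hext (insert e B) e (Finset.mem_insert_self _ _) col (by
    intro x hx y hy hxy hcxy hC
    by_cases hxB : x ∈ B
    · by_cases hyB : y ∈ B
      · rw [hcolB x hxB, hcolB y hyB] at hcxy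
        rw [hcolB x hxB] at hC
        have h3 := h1 _ (hinv x hxB) _ (hinv y hyB)
        have hne' : inv x ≠ inv y := fun h => hxy (h3.1.1 h)
        have a1 := hk c (inv x) (hne x hxB)
        have a2 := hk c (inv y) (hne y hyB)
        rw [← hcxy] at a2
        exact ht _ c (inv x) (inv y) (hne x hxB) hne' (hne y hyB) ⟨a1, (h3.2 _).2 hC, a2⟩
      · rw [hcolB x hxB, hcolN y hyB] at hcxy
        exact hN' x hxB hcxy
    · by_cases hyB : y ∈ B
      · rw [hcolB y hyB, hcolN x hxB] at hcxy
        exact hN' y hyB hcxy.symm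
      · rcases Finset.mem_insert.1 hx with rfl | hx
        · rcases Finset.mem_insert.1 hy with rfl | hy
          · exact hxy rfl
          · exact hyB hy
        · exact hxB hx)
  have hdB : d ∉ B := fun h => hd (Finset.mem_insert_of_mem h)
  have key : ∀ p ∈ F, c ≠ p.1 ∧ d ≠ p.2 ∧ ∀ i, C i c p.1 ↔ C i d p.2 := by
    rintro ⟨a, b⟩ hab
    have hb : b ∈ B := Finset.mem_image.2 ⟨_, hab, rfl⟩
    have hia := hinv' a b hab
    have hca : c ≠ a := hia ▸ hne b hb
    have hdb : d ≠ b := fun h => hdB (h ▸ hb)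
    refine ⟨hca, hdb, fun i => ?_⟩
    have e1 := hk c a hca
    have e2 := hdC b (Finset.mem_insert_of_mem hb)
    rw [hcolB b hb, hia] at e2
    constructor
    · intro h
      rw [(hu c a hca).unique h e1]; exact e2
    · intro h
      rw [(hu d b hdb).unique h e2]; exact e1
  refine ⟨insert (c, d) F, Finset.subset_insert _ _, ⟨?_, ?_⟩, d, Finset.mem_insert_self _ _⟩
  · intro p hp q hq
    rcases Finset.mem_insert.1 hp with rfl | hp
    · rcases Finset.mem_insert.1 hq with rfl | hq
      · exact ⟨by simp, fun i => ⟨fun h => absurd h (hi _ _), fun h => absurd h (hi _ _)⟩⟩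
      · obtain ⟨k1, k2, k3⟩ := key q hq
        exact ⟨⟨fun h => absurd h k1, fun h => absurd h k2⟩, k3⟩
    · rcases Finset.mem_insert.1 hq with rfl | hq
      · obtain ⟨k1, k2, k3⟩ := key p hp
        exact ⟨⟨fun h => absurd h.symm k1, fun h => absurd h.symm k2⟩,
          fun i => ⟨fun h => hs _ _ _ ((k3 i).1 (hs _ _ _ h)), fun h => hs _ _ _ ((k3 i).2 (hs _ _ _ h))⟩⟩
      · exact h1 p hp q hq
  · intro p hp
    rcases Finset.mem_insert.1 hp with rfl | hp
    · exact ((hcl _ _).1 hde).trans he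
    · exact h2 p hp

theorem GoodF.main {M Q : Type*} [Countable M] {E : M → M → Prop} {C : ℕ → M → M → Prop}
    (hK : IsKStruct E C)
    {cl : M → Q} (hcl : ∀ x y, E x y ↔ cl x = cl y) (hsurj : Function.Surjective cl)
    (hext : ∀ (s : Finset M) (e : M) (_ : e ∈ s) (col : M → ℕ)
      (_ : ∀ x ∈ s, ∀ y ∈ s, x ≠ y → col x = col y → ¬ C (col x) x y),
      ∃ d, d ∉ s ∧ E d e ∧ ∀ x ∈ s, C (col x) d x)
    (π : Q ≃ Q) :
    ∃ g : M ≃ M, (∀ x y : M, E x y ↔ E (g x) (g y)) ∧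
        (∀ (i : ℕ) (x y : M), C i x y ↔ C i (g x) (g y)) ∧
        ∀ x : M, cl (g x) = π (cl x) := by
  classical
  let P := {F : Finset (M × M) // GoodF C cl π F}
  let _ : Encodable (M ⊕ M) := Encodable.ofCountable _
  let D : M ⊕ M → Order.Cofinal P := fun m => match m with
    | Sum.inl c => ⟨{F | ∃ d, (c, d) ∈ F.1}, fun F => by
        obtain ⟨F', h1, h2, h3⟩ := GoodF.extend hK hcl hsurj hext F.2 c
        exact ⟨⟨F', h2⟩, h3, h1⟩⟩
    | Sum.inr c => ⟨{F | ∃ d, (d, c) ∈ F.1}, fun F => by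
        obtain ⟨F', h1, h2, d, h3⟩ := GoodF.extend hK hcl hsurj hext F.2.swap c
        refine ⟨⟨_, h2.swap⟩, ⟨d, ?_⟩, ?_⟩
        · rw [Finset.mem_map_equiv]; exact h3
        · intro p hp
          change p ∈ Finset.map _ _
          rw [Finset.mem_map_equiv]
          apply h1
          rw [Finset.mem_map_equiv]
          exact hp⟩
  let I := Order.idealOfCofinals (⟨∅, by simp [GoodF]⟩ : P) D
  have hl : ∀ c, ∃ d, ∃ F ∈ I, (c, d) ∈ F.1 := fun c => by
    obtain ⟨F, ⟨d, hd⟩, hF⟩ := Order.cofinal_meets_idealOfCofinals (⟨∅, by simp [GoodF]⟩ : P) D (Sum.inl c)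
    exact ⟨d, F, hF, hd⟩
  have hr : ∀ c, ∃ d, ∃ F ∈ I, (d, c) ∈ F.1 := fun c => by
    obtain ⟨F, ⟨d, hd⟩, hF⟩ := Order.cofinal_meets_idealOfCofinals (⟨∅, by simp [GoodF]⟩ : P) D (Sum.inr c)
    exact ⟨d, F, hF, hd⟩
  choose u hu using hl
  choose v hv using hr
  have comp : ∀ a b a' b', (∃ F ∈ I, (a, b) ∈ F.1) → (∃ F ∈ I, (a', b') ∈ F.1) →
      (a = a' ↔ b = b') ∧ ∀ i, C i a a' ↔ C i b b' := by
    rintro a b a' b' ⟨F, hF, h⟩ ⟨F', hF', h'⟩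
    obtain ⟨G, hG, h1, h2⟩ := I.directed F hF F' hF'
    exact G.2.1 _ (h1 h) _ (h2 h')
  have hπ : ∀ x, cl (u x) = π (cl x) := fun x => by
    obtain ⟨F, _, h⟩ := hu x
    exact F.2.2 _ h
  refine ⟨⟨u, v, fun x => (comp _ _ _ _ (hv (u x)) (hu x)).1.2 rfl,
    fun x => (comp _ _ _ _ (hu (v x)) (hv x)).1.1 rfl⟩, ?_, ?_, hπ⟩
  · intro x y
    change _ ↔ E (u x) (u y)
    rw [hcl, hcl, hπ, hπ, π.apply_eq_iff_eq]
  · intro i x y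
    exact (comp _ _ _ _ (hu x) (hu y)).2 i

/-- In the Fraïssé limit `M` of the class `K` of finite edge-colored equivalence
structures without monochromatic triangles — i.e., the countable structure satisfying
the axioms of `K`, whose age contains every structure of `K`, and which is
ultrahomogeneous — every permutation of the `E`-equivalence classes of `M` extends to an
automorphism of `M`. -/
theorem fraisseLimit_class_homogeneous {M : Type*} [Countable M]
    (E : M → M → Prop) (C : ℕ → M → M → Prop)
    (hE : Equivalence E)
    (hK : IsKStruct E C)
    (hage : ∀ (V : Type) [Fintype V] (E' : V → V → Prop) (C' : ℕ → V → V → Prop),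
      IsKStruct E' C' → ∃ f : V → M, IsKEmb E' C' E C f)
    (hhom : ∀ (s : Finset M) (f : M → M), Set.InjOn f ↑s →
      (∀ x ∈ s, ∀ y ∈ s, (E x y ↔ E (f x) (f y)) ∧ ∀ i : ℕ, C i x y ↔ C i (f x) (f y)) →
      ∃ g : M ≃ M, (∀ x y : M, E x y ↔ E (g x) (g y)) ∧
        (∀ (i : ℕ) (x y : M), C i x y ↔ C i (g x) (g y)) ∧ ∀ x ∈ s, g x = f x) :
    ∀ π : Quotient (Setoid.mk E hE) ≃ Quotient (Setoid.mk E hE),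
      ∃ g : M ≃ M, (∀ x y : M, E x y ↔ E (g x) (g y)) ∧
        (∀ (i : ℕ) (x y : M), C i x y ↔ C i (g x) (g y)) ∧
        ∀ x : M, (⟦g x⟧ : Quotient (Setoid.mk E hE)) = π ⟦x⟧ := by
  intro π
  exact GoodF.main hK (cl := fun x => (Quotient.mk (Setoid.mk E hE) x))
    (fun x y => ⟨fun h => Quotient.sound h, fun h => Quotient.exact h⟩) Quotient.mk_surjective
    (ext_aux E C hK hage hhom) π
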